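/- Let p be an odd prime and G = ℤ/p × ℤ/p. The integral group cohomology of G (with trivial coefficients) satisfies: H⁰(G;ℤ) ≅ ℤ; H¹(G;ℤ) = 0; for every odd k > 1, H^k(G;ℤ) is isomorphic to the direct sum of (k−1)/2 copies of ℤ/p; and for every even k > 1, H^k(G;ℤ) is isomorphic to the direct sum of (k+2)/2 copies of ℤ/p. -/

import Mathlib

set_option linter.unusedSectionVars false

namespace ZpZp

abbrev Gp (p : ℕ) := Multiplicative (ZMod p × ZMod p)
abbrev Rg (p : ℕ) := MonoidAlgebra ℤ (Gp p)

noncomputable section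

variable (p : ℕ) [Fact p.Prime]

abbrev sg (u v : ZMod p) : Rg p := MonoidAlgebra.single (Multiplicative.ofAdd (u, v)) 1

variable {p}
lemma sg_mul (u v u' v' : ZMod p) : sg p u v * sg p u' v' = sg p (u+u') (v+v') := by
  simp [sg, MonoidAlgebra.single_mul_single, ← ofAdd_add]

lemma one_eq : (1 : Rg p) = sg p 0 0 := rfl

lemma hom_ext' {M : Type*} [AddCommGroup M] (f g : Rg p →+ M) (h : ∀ u v, f (sg p u v) = g (sg p u v))
    (r : Rg p) : f r = g r := by
  have : f = g := by
    apply MonoidAlgebra.addMonoidHom_ext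
    intro x n
    have : (MonoidAlgebra.single x n : Rg p) = n • sg p x.toAdd.1 x.toAdd.2 := by
      simp [sg]
    rw [this, map_zsmul, map_zsmul, h]
  rw [this]

variable (p) in
def swp : Rg p →+* Rg p := MonoidAlgebra.mapDomainRingHom ℤ
  (AddMonoidHom.toMultiplicative ((AddMonoidHom.snd (ZMod p) (ZMod p)).prod (AddMonoidHom.fst _ _)))

variable (p) in
def prx : Rg p →+* Rg p := MonoidAlgebra.mapDomainRingHom ℤ
  (AddMonoidHom.toMultiplicative ((0 : ZMod p × ZMod p →+ ZMod p).prod (AddMonoidHom.snd _ _)))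

variable (p) in
def aug : Rg p →ₐ[ℤ] ℤ := MonoidAlgebra.lift ℤ ℤ (Gp p) 1

lemma swp_sg (u v : ZMod p) : swp p (sg p u v) = sg p v u := by
  simp [swp, sg]

lemma prx_sg (u v : ZMod p) : prx p (sg p u v) = sg p 0 v := by
  simp [prx, sg]

lemma aug_sg (u v : ZMod p) : aug p (sg p u v) = 1 := by
  simp [aug, sg]

lemma aug_single (g : Gp p) : aug p (MonoidAlgebra.single g 1) = 1 := by
  simp [aug]

lemma swp_swp (r : Rg p) : swp p (swp p r) = r :=
  hom_ext' ((swp p).comp (swp p)).toAddMonoidHom (AddMonoidHom.id _)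
    (fun u v => by simp [swp_sg]) r

variable (p) in
def ea : Rg p := sg p 1 0 - 1
variable (p) in
def eN : Rg p := ∑ u : ZMod p, sg p u 0
variable (p) in
def eb : Rg p := sg p 0 1 - 1
variable (p) in
def eM : Rg p := ∑ u : ZMod p, sg p 0 u

lemma swp_ea : swp p (ea p) = eb p := by simp [ea, eb, swp_sg]
lemma swp_eb : swp p (eb p) = ea p := by simp [ea, eb, swp_sg]
lemma swp_eN : swp p (eN p) = eM p := by simp [eN, eM, swp_sg]
lemma swp_eM : swp p (eM p) = eN p := by simp [eN, eM, swp_sg]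
lemma prx_ea : prx p (ea p) = 0 := by simp [ea, prx_sg, one_eq]
lemma prx_eb : prx p (eb p) = eb p := by simp [eb, prx_sg]
lemma prx_eM : prx p (eM p) = eM p := by simp [eM, prx_sg]
lemma aug_ea : aug p (ea p) = 0 := by simp [ea, aug_sg]
lemma aug_eb : aug p (eb p) = 0 := by simp [eb, aug_sg]
lemma aug_eN : aug p (eN p) = p := by simp [eN, aug_sg, ZMod.card]
lemma aug_eM : aug p (eM p) = p := by simp [eM, aug_sg, ZMod.card]

def hh (F : ZMod p → ZMod p → Rg p) : Rg p →+ Rg p :=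
  ((Finsupp.linearCombination ℤ (fun g : Gp p => F g.toAdd.1 g.toAdd.2)) ∘ₗ
    (MonoidAlgebra.coeffLinearEquiv ℤ).toLinearMap).toAddMonoidHom

lemma hh_sg (F : ZMod p → ZMod p → Rg p) (u v : ZMod p) : hh F (sg p u v) = F u v := by
  simp [hh, sg]

lemma ea_sg (u v : ZMod p) : ea p * sg p u v = sg p (u + 1) v - sg p u v := by
  rw [ea, sub_mul, sg_mul, one_mul, zero_add, add_comm]

lemma eN_sg (u v : ZMod p) : eN p * sg p u v = ∑ w : ZMod p, sg p w v := by
  rw [eN, Finset.sum_mul]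
  simp only [sg_mul, zero_add]
  exact Fintype.sum_equiv (Equiv.addRight u) _ _ (fun w => rfl)

variable (p) in
def h0 : Rg p →+ Rg p := hh (fun u v => ∑ j ∈ Finset.range u.val, sg p (j : ZMod p) v)
variable (p) in
def h1 : Rg p →+ Rg p := hh (fun u v => if u = -1 then sg p 0 v else 0)

lemma ea_h0 (r : Rg p) : ea p * h0 p r = r - prx p r := by
  refine hom_ext' ((AddMonoidHom.mulLeft (ea p)).comp (h0 p))
    (AddMonoidHom.id _ - (prx p).toAddMonoidHom) (fun u v => ?_) r
  simp only [AddMonoidHom.comp_apply, AddMonoidHom.coe_mulLeft, h0, hh_sg, AddMonoidHom.sub_apply,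
    AddMonoidHom.id_apply, RingHom.toAddMonoidHom_eq_coe, AddMonoidHom.coe_coe, prx_sg,
    Finset.mul_sum, ea_sg]
  have := Finset.sum_range_sub (fun j : ℕ => sg p (j : ZMod p) v) u.val
  simp only [Nat.cast_add, Nat.cast_one, Nat.cast_zero, ZMod.natCast_val, ZMod.cast_id', id] at this
  exact this

lemma h1_eN (r : Rg p) : h1 p (eN p * r) = prx p r := by
  refine hom_ext' ((h1 p).comp (AddMonoidHom.mulLeft (eN p)))
    ((prx p).toAddMonoidHom) (fun u v => ?_) r
  simp only [AddMonoidHom.comp_apply, AddMonoidHom.coe_mulLeft, h1,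
    RingHom.toAddMonoidHom_eq_coe, AddMonoidHom.coe_coe, prx_sg, eN_sg, map_sum, hh_sg]
  simp

lemma sum_zmod (F : ZMod p → Rg p) : ∑ w : ZMod p, F w = ∑ j ∈ Finset.range p, F (j : ZMod p) := by
  have hp0 : NeZero p := ⟨(Fact.out : p.Prime).ne_zero⟩
  symm
  refine Finset.sum_bij (fun j _ => (j : ZMod p)) (by simp) ?_ ?_ (by simp)
  · intro i hi j hj h
    have := congrArg ZMod.val h
    simp only [Finset.mem_range] at hi hj
    rwa [ZMod.val_cast_of_lt hi, ZMod.val_cast_of_lt hj] at this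
  · intro w _
    exact ⟨w.val, by simp [ZMod.val_lt], by simp⟩

lemma eN_h1 (r : Rg p) : eN p * h1 p r + h0 p (ea p * r) = r := by
  have hp := (Fact.out : p.Prime)
  refine hom_ext' ((AddMonoidHom.mulLeft (eN p)).comp (h1 p) + (h0 p).comp (AddMonoidHom.mulLeft (ea p)))
    (AddMonoidHom.id _) (fun u v => ?_) r
  simp only [AddMonoidHom.add_apply, AddMonoidHom.comp_apply, AddMonoidHom.coe_mulLeft, h1, h0, 
    AddMonoidHom.id_apply, ea_sg, map_sub, hh_sg]
  obtain ⟨q, rfl⟩ : ∃ q, p = q + 1 := ⟨p - 1, by have := hp.pos; omega⟩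
  split_ifs with h
  · subst h
    rw [eN_sg, sum_zmod, Finset.sum_range_succ, neg_add_cancel, ZMod.val_zero, ZMod.val_neg_one]
    have : ((q : ℕ) : ZMod (q+1)) = -1 := by
      rw [eq_neg_iff_add_eq_zero]; exact_mod_cast ZMod.natCast_self (q+1)
    simp [this]
  · have hlt : u.val < q := by
      have h1 := ZMod.val_lt u
      have h2 : u.val ≠ q := by
        intro h2
        apply h
        exact ZMod.val_injective _ (h2.trans (ZMod.val_neg_one q).symm)
      omega
    have : (u + 1).val = u.val + 1 := by
      have hq : 1 < q + 1 := hp.one_lt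
      have : Fact (1 < q + 1) := ⟨hq⟩
      rw [ZMod.val_add_of_lt, ZMod.val_one]
      rw [ZMod.val_one]; omega
    rw [this, Finset.sum_range_succ]
    simp

lemma ea_eN : ea p * eN p = 0 := by
  have h := eN_sg (p := p) 1 0
  have h' : eN p * ea p = 0 := by
    rw [ea, mul_sub, h, mul_one, eN, sub_self]
  rw [mul_comm, h']

lemma exact_a {r : Rg p} (h : ea p * r = 0) : ∃ s, eN p * s = r :=
  ⟨h1 p r, by simpa [h] using eN_h1 r⟩

lemma exact_N {r : Rg p} (h : eN p * r = 0) : ∃ s, ea p * s = r :=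
  ⟨h0 p r, by rw [ea_h0, ← h1_eN, h]; simp⟩

lemma eb_eM : eb p * eM p = 0 := by
  rw [← swp_ea, ← swp_eN, ← map_mul, ea_eN, map_zero]

lemma exact_b {r : Rg p} (h : eb p * r = 0) : ∃ s, eM p * s = r := by
  obtain ⟨s, hs⟩ := exact_a (p := p) (r := swp p r) (by rw [← swp_eb, ← map_mul, h, map_zero])
  exact ⟨swp p s, by rw [← swp_eN, ← map_mul, hs, swp_swp]⟩

lemma exact_M {r : Rg p} (h : eM p * r = 0) : ∃ s, eb p * s = r := by
  obtain ⟨s, hs⟩ := exact_N (p := p) (r := swp p r) (by rw [← swp_eM, ← map_mul, h, map_zero])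
  exact ⟨swp p s, by rw [← swp_ea, ← map_mul, hs, swp_swp]⟩

/-- exactness of `b`, `M` modulo `a` -/
lemma exact_b' {r t : Rg p} (h : ea p * t + eb p * r = 0) : ∃ s s', ea p * s + eM p * s' = r := by
  have := congrArg (prx p) h
  simp only [map_add, map_mul, prx_ea, prx_eb, zero_mul, zero_add, map_zero] at this
  obtain ⟨s, hs⟩ := exact_b this
  exact ⟨h0 p r, s, by rw [hs, ea_h0]; ring⟩

lemma exact_M' {r t : Rg p} (h : ea p * t + eM p * r = 0) : ∃ s s', ea p * s + eb p * s' = r := by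
  have := congrArg (prx p) h
  simp only [map_add, map_mul, prx_ea, prx_eM, zero_mul, zero_add, map_zero] at this
  obtain ⟨s, hs⟩ := exact_M this
  exact ⟨h0 p r, s, by rw [hs, ea_h0]; ring⟩

lemma exact_aug {r : Rg p} (h : aug p r = 0) : ∃ s s', ea p * s + eb p * s' = r := by
  refine ⟨h0 p r, swp p (h0 p (swp p (prx p r))), ?_⟩
  rw [← swp_ea, ← map_mul, ea_h0, ea_h0, map_sub, swp_swp]
  have : swp p (prx p (swp p (prx p r))) = algebraMap ℤ (Rg p) (aug p r) := by
    refine hom_ext' (((swp p).comp (prx p)).comp ((swp p).comp (prx p))).toAddMonoidHom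
      ((algebraMap ℤ (Rg p)).comp (aug p).toRingHom).toAddMonoidHom (fun u v => ?_) r
    simp [prx_sg, swp_sg, aug_sg]
    rfl
  rw [this, h]
  simp

variable (p) in
def cA (m : ℕ) : Rg p := if Even m then eN p else ea p
variable (p) in
def cB (m : ℕ) : Rg p := if Even m then eM p else eb p

lemma cA_mul (m : ℕ) : cA p m * cA p (m+1) = 0 := by
  by_cases h : Even m
  · simp [cA, h, Nat.even_add_one, mul_comm (eN p), ea_eN]
  · simp [cA, h, Nat.even_add_one, ea_eN]

lemma cB_mul (m : ℕ) : cB p m * cB p (m+1) = 0 := by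
  by_cases h : Even m
  · simp [cB, h, Nat.even_add_one, mul_comm (eM p), eb_eM]
  · simp [cB, h, Nat.even_add_one, eb_eM]

lemma exact_cA (m : ℕ) {r : Rg p} (hr : cA p m * r = 0) : ∃ s, cA p (m+1) * s = r := by
  by_cases h : Even m
  · simp only [cA, h, Nat.even_add_one, if_true, not_true, if_false] at hr ⊢; exact exact_N hr
  · simp only [cA, h, Nat.even_add_one, if_true, not_false_iff, if_false] at hr ⊢; exact exact_a hr

lemma exact_cB (m : ℕ) {r t : Rg p} (hr : cA p 1 * t + cB p m * r = 0) :
    ∃ s s', cA p 1 * s + cB p (m+1) * s' = r := by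
  have h1 : cA p 1 = ea p := by simp [cA]
  rw [h1] at hr ⊢
  by_cases h : Even m
  · simp only [cB, h, Nat.even_add_one, if_true, not_true, if_false] at hr ⊢; exact exact_M' hr
  · simp only [cB, h, Nat.even_add_one, if_true, not_false_iff, if_false] at hr ⊢; exact exact_b' hr

lemma exact_nat (n : ℕ) (f : ℕ → Rg p)
    (hf : ∀ i ≤ n, cA p (i+1) * f (i+1) + (-1)^i * cB p (n+1-i) * f i = 0) (m : ℕ) :
    m ≤ n + 1 → 
    ∃ g : ℕ → Rg p, ∀ i ≤ m, cA p (i+1) * g (i+1) + (-1)^i * cB p (n+2-i) * g i = f i := by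
  induction m with
  | zero =>
    intro _
    have h := hf 0 (Nat.zero_le _)
    simp only [zero_add, pow_zero, one_mul, Nat.sub_zero] at h
    obtain ⟨s, s', hs⟩ := exact_cB _ h
    refine ⟨fun i => if i = 0 then s' else s, fun i hi => ?_⟩
    obtain rfl : i = 0 := by omega
    simpa using hs
  | succ m ih =>
    intro hm
    obtain ⟨g, hg⟩ := ih (by omega)
    have hz : cA p (m+1) * (f (m+1) - (-1)^(m+1) * cB p (n+2-(m+1)) * g (m+1)) = 0 := by
      have h1 := hf m (by omega)
      have h2 := hg m le_rfl
      have h3 : cB p (n+1-m) * cB p (n+2-m) = 0 := by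
        have := cB_mul (p := p) (n+1-m)
        rwa [show n+1-m+1 = n+2-m by omega] at this
      rw [show n+2-(m+1) = n+1-m by omega]
      have hs : ((-1 : Rg p)^m) * (-1)^m = 1 := by rw [← mul_pow]; simp
      rw [← h2] at h1
      linear_combination h1 - g m * h3 * (-1)^m * (-1)^m
    obtain ⟨s, hs⟩ := exact_cA _ hz
    refine ⟨Function.update g (m+2) s, fun i hi => ?_⟩
    rcases Nat.lt_or_ge i (m+1) with h | h
    · rw [Function.update_of_ne (by omega), Function.update_of_ne (by omega)]
      exact hg i (by omega)
    · obtain rfl : i = m+1 := by omega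
      rw [Function.update_self, Function.update_of_ne (by omega), hs]
      ring

def ext0 {n : ℕ} {M : Type*} [Zero M] (f : Fin n → M) (i : ℕ) : M := if h : i < n then f ⟨i, h⟩ else 0

lemma ext0_val {n : ℕ} {M : Type*} [Zero M] (f : Fin n → M) (i : Fin n) : ext0 f i = f i := by
  simp [ext0]

variable (p) in
/-- the differential -/
def dd (n : ℕ) : (Fin (n+2) → Rg p) →ₗ[Rg p] (Fin (n+1) → Rg p) where
  toFun f i := cA p (i+1) * f i.succ + (-1)^(i:ℕ) * cB p (n+1-i) * f i.castSucc
  map_add' f g := by ext1 i; simp; ring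
  map_smul' f g := by ext1 i; simp; ring

lemma dd_apply (n : ℕ) (f : Fin (n+2) → Rg p) (i : Fin (n+1)) : dd p n f i =
  cA p (i+1) * f i.succ + (-1)^(i:ℕ) * cB p (n+1-i) * f i.castSucc := rfl

lemma dd_dd (n : ℕ) (f : Fin (n+3) → Rg p) : dd p n (dd p (n+1) f) = 0 := by
  ext1 i
  simp only [dd_apply, Fin.val_succ, Fin.val_castSucc, Pi.zero_apply, Fin.succ_castSucc]
  have h1 := cA_mul (p := p) (i+1)
  have h2 := cB_mul (p := p) (n+1-i)
  have hi : (i : ℕ) ≤ n := by omega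
  rw [show n+1-(i:ℕ)+1 = n+1+1-i by omega] at h2
  rw [show n + 1 + 1 - ((i:ℕ) + 1) = n+1-i by omega]
  linear_combination f i.succ.succ * h1 + (-1)^(i:ℕ) * (-1)^(i:ℕ) * f i.castSucc.castSucc * h2

lemma dd_exact (n : ℕ) (f : Fin (n+2) → Rg p) (hf : dd p n f = 0) : ∃ g, dd p (n+1) g = f := by
  obtain ⟨g, hg⟩ := exact_nat n (ext0 f) (fun i hi => by
    have := congrFun hf ⟨i, by omega⟩
    rw [dd_apply, ← ext0_val f, ← ext0_val f] at this
    exact this) (n+1) le_rfl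
  refine ⟨fun i => g i, ?_⟩
  ext1 i
  rw [dd_apply, ← ext0_val f]
  exact hg i (by omega)


open CategoryTheory

section generic
universe u
variable {k G : Type u} [CommRing k] [CommGroup G]

variable (k G) in
def rhoP (n : ℕ) : Representation k G (Fin (n+1) → MonoidAlgebra k G) where
  toFun g := (LinearMap.lsmul (MonoidAlgebra k G) (Fin (n+1) → MonoidAlgebra k G)
    (MonoidAlgebra.single g 1 : MonoidAlgebra k G)).restrictScalars k
  map_one' := LinearMap.ext fun x => one_smul (MonoidAlgebra k G) x
  map_mul' g h := LinearMap.ext fun x => by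
    change (MonoidAlgebra.single (g * h) 1 : MonoidAlgebra k G) • x =
      (MonoidAlgebra.single g 1 : MonoidAlgebra k G) • (MonoidAlgebra.single h 1 : MonoidAlgebra k G) • x
    rw [smul_smul, MonoidAlgebra.single_mul_single, mul_one]

lemma rhoP_apply (n : ℕ) (g : G) (f : Fin (n+1) → MonoidAlgebra k G) :
  rhoP k G n g f = (MonoidAlgebra.single g 1 : MonoidAlgebra k G) • f := rfl

variable (k G) in
abbrev PP (n : ℕ) : Rep k G := Rep.of (rhoP k G n)

def homP {n m : ℕ} (L : (Fin (n+1) → MonoidAlgebra k G) →ₗ[MonoidAlgebra k G]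
    (Fin (m+1) → MonoidAlgebra k G)) : PP k G n ⟶ PP k G m :=
  Rep.ofHom ⟨L.restrictScalars k, fun _ => LinearMap.ext fun x => L.map_smul _ x⟩

lemma homP_apply {n m : ℕ} (L : (Fin (n+1) → MonoidAlgebra k G) →ₗ[MonoidAlgebra k G]
    (Fin (m+1) → MonoidAlgebra k G)) (f : Fin (n+1) → MonoidAlgebra k G) :
    (homP L).hom f = L f := rfl

def liftP {n : ℕ} {A : Rep.{u} k G} (v : Fin (n+1) → A) : PP k G n ⟶ A :=
  Rep.ofHom ⟨∑ i, (LinearMap.applyₗ (v i)) ∘ₗ A.ρ.asAlgebraHom.toLinearMap ∘ₗ LinearMap.proj i,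
    fun g => LinearMap.ext fun x => by simp [rhoP_apply]⟩

lemma liftP_apply {n : ℕ} {A : Rep.{u} k G} (v : Fin (n+1) → A) (f : Fin (n+1) → MonoidAlgebra k G) :
    (liftP v).hom f = ∑ i, A.ρ.asAlgebraHom (f i) (v i) := by
  change (∑ i, (LinearMap.applyₗ (v i)) ∘ₗ A.ρ.asAlgebraHom.toLinearMap ∘ₗ LinearMap.proj i :
    (Fin (n+1) → MonoidAlgebra k G) →ₗ[k] A) f = _
  simp

lemma hom_smul {n : ℕ} {A : Rep.{u} k G} (φ : PP k G n ⟶ A) (r : MonoidAlgebra k G)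
    (f : Fin (n+1) → MonoidAlgebra k G) :
    φ.hom (r • f) = A.ρ.asAlgebraHom r (φ.hom f) := by
  induction r using MonoidAlgebra.induction_linear with
  | zero => simp
  | add x y hx hy => 
    rw [add_smul, map_add]
    simp [hx, hy]
  | single g n =>
    have h : (MonoidAlgebra.single g n : MonoidAlgebra k G) = n • MonoidAlgebra.single g 1 := by simp
    rw [h, smul_assoc, map_smul φ.hom, map_smul A.ρ.asAlgebraHom, Representation.asAlgebraHom_single_one]
    exact congrArg (n • ·) (Rep.hom_comm_apply φ g f)

lemma hom_eq {n : ℕ} {A : Rep.{u} k G} (φ : PP k G n ⟶ A) (f : Fin (n+1) → MonoidAlgebra k G) :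
    φ.hom f = ∑ i, A.ρ.asAlgebraHom (f i) (φ.hom (Pi.single i 1 : Fin (n+1) → MonoidAlgebra k G)) := by
  have : f = ∑ i, f i • (Pi.single i 1 : Fin (n+1) → MonoidAlgebra k G) := pi_eq_sum_univ' f
  conv_lhs => rw [this, map_sum]
  exact Finset.sum_congr rfl fun i _ => hom_smul φ _ _

lemma liftP_single {n : ℕ} {A : Rep.{u} k G} (v : Fin (n+1) → A) (i : Fin (n+1)) :
    (liftP v).hom (Pi.single i 1 : Fin (n+1) → MonoidAlgebra k G) = v i := by
  rw [liftP_apply, Finset.sum_eq_single i]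
  · simp
  · intro j _ hj
    simp [hj]
  · simp

lemma hom_ext2 {n : ℕ} {A : Rep.{u} k G} {φ ψ : PP k G n ⟶ A}
    (h : ∀ i, φ.hom (Pi.single i 1 : Fin (n+1) → MonoidAlgebra k G) =
      ψ.hom (Pi.single i 1 : Fin (n+1) → MonoidAlgebra k G)) :
    φ = ψ := by
  apply Rep.hom_ext
  apply Representation.IntertwiningMap.ext
  refine LinearMap.ext fun f => ?_
  have h1 := hom_eq φ f
  have h2 := hom_eq ψ f
  simp_rw [h] at h1
  exact h1.trans h2.symm

instance (n : ℕ) : Projective (PP k G n) where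
  factors {E X} f e he := by
    have hs := (Rep.epi_iff_surjective e).1 he
    choose s hs using hs
    refine ⟨liftP (fun i => s (f.hom (Pi.single i 1 : Fin (n+1) → MonoidAlgebra k G))), ?_⟩
    apply hom_ext2
    intro i
    change e.hom ((liftP _).hom _) = _
    rw [liftP_single, hs]

def homEq (n : ℕ) (A : Rep.{u} k G) : (PP k G n ⟶ A) ≃ₗ[k] (Fin (n+1) → A) where
  toFun φ i := φ.hom (Pi.single i 1 : Fin (n+1) → MonoidAlgebra k G)
  invFun v := liftP v
  map_add' _ _ := rfl
  map_smul' _ _ := rfl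
  left_inv _ := hom_ext2 fun _ => liftP_single _ _
  right_inv _ := funext fun _ => liftP_single _ _

lemma rep_exact (S : ShortComplex (Rep.{u} k G))
    (h : ∀ x, S.g.hom x = 0 → ∃ y, S.f.hom y = x) : S.Exact := by
  apply (forget₂ (Rep.{u} k G) (ModuleCat.{u} k)).reflects_exact_of_faithful
  rw [ShortComplex.moduleCat_exact_iff]
  exact h

end generic

variable (p) in
abbrev dP (n : ℕ) : PP ℤ (Gp p) (n+1) ⟶ PP ℤ (Gp p) n := homP (dd p n)

variable (p) in
abbrev TT : Rep ℤ (Gp p) := Rep.trivial ℤ (Gp p) ℤ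

lemma dP_dP (n : ℕ) : dP p (n+1) ≫ dP p n = 0 := by
  apply Rep.hom_ext
  apply Representation.IntertwiningMap.ext
  exact LinearMap.ext fun f => dd_dd n f

variable (p) in
def CC : ChainComplex (Rep ℤ (Gp p)) ℕ := ChainComplex.of (PP ℤ (Gp p)) (dP p) dP_dP

variable (p) in
def epsP : PP ℤ (Gp p) 0 ⟶ TT p := liftP (fun _ => (1:ℤ))

lemma asAlg_TT (r : Rg p) (x : ℤ) : (TT p).ρ.asAlgebraHom r x = aug p r * x := by
  refine hom_ext' ((LinearMap.applyₗ x) ∘ₗ (TT p).ρ.asAlgebraHom.toLinearMap).toAddMonoidHom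
      ((AddMonoidHom.mulRight x).comp (aug p).toLinearMap.toAddMonoidHom) (fun u v => ?_) r
  simp [aug_sg]

lemma epsP_apply (f : Fin 1 → Rg p) : (epsP p).hom f = aug p (f 0) := by
  refine (liftP_apply _ f).trans ?_
  rw [Fin.sum_univ_one, asAlg_TT, mul_one]

lemma CC_d (n : ℕ) : (CC p).d (n+1) n = dP p n := ChainComplex.of_d ..

lemma dP_eps : dP p 0 ≫ epsP p = 0 := by
  apply Rep.hom_ext
  apply Representation.IntertwiningMap.ext
  refine LinearMap.ext fun f => ?_
  change (epsP p).hom (dd p 0 f) = 0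
  rw [epsP_apply, dd_apply]
  simp [cA, cB, aug_ea, aug_eb]

variable (p) in
def piP : CC p ⟶ (ChainComplex.single₀ (Rep ℤ (Gp p))).obj (TT p) :=
  ((CC p).toSingle₀Equiv _).symm ⟨epsP p, by rw [CC_d]; exact dP_eps⟩


lemma piP_quasiIso : QuasiIso (piP p) where
  quasiIsoAt m := by
    induction m with
    | zero =>
      rw [piP, ChainComplex.quasiIsoAt₀_iff, ShortComplex.quasiIso_iff_of_zeros' _ rfl rfl rfl]
      constructor
      · apply rep_exact
        intro (f : Fin 1 → Rg p) hf
        have hf' : (epsP p).hom f = 0 := hf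
        rw [epsP_apply] at hf'
        obtain ⟨r, t, h⟩ := exact_aug hf'
        refine ⟨(![t, r] : Fin 2 → Rg p), ?_⟩
        have : dd p 0 ![t, r] = f := by
          ext1 i
          obtain rfl : i = 0 := Fin.fin_one_eq_zero i
          rw [dd_apply]
          simpa [cA, cB] using h
        have h2 := CC_d (p := p) 0
        change ((CC p).d (0+1) 0).hom (![t, r] : Fin 2 → Rg p) = f
        rw [h2]
        exact this
      · rw [Rep.epi_iff_surjective]
        intro (x : ℤ)
        refine ⟨(fun _ => algebraMap ℤ (Rg p) x : Fin 1 → Rg p), ?_⟩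
        change (epsP p).hom (fun _ => algebraMap ℤ (Rg p) x : Fin 1 → Rg p) = x
        rw [epsP_apply]
        simp
    | succ m _ =>
      rw [quasiIsoAt_iff_exactAt' (hL := ChainComplex.exactAt_succ_single_obj ..),
          HomologicalComplex.exactAt_iff' _ (m + 2) (m + 1) m (by simp) (by simp)]
      apply rep_exact
      intro (f : Fin (m+2) → Rg p) hf
      have hf' : ((CC p).d (m+1) m).hom f = 0 := hf
      rw [CC_d] at hf'
      obtain ⟨g, hg⟩ := dd_exact m f hf'
      refine ⟨g, ?_⟩
      change ((CC p).d (m+1+1) (m+1)).hom g = f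
      rw [CC_d]
      exact hg

variable (p) in
def resP : ProjectiveResolution (TT p) where
  complex := CC p
  projective n := inferInstanceAs (Projective (PP ℤ (Gp p) n))
  π := piP p
  quasiIso := piP_quasiIso

section hom
universe u
variable {k : Type u} [CommRing k]

lemma homology_of (K : CochainComplex (ModuleCat.{u} k) ℕ) (n : ℕ) {M : Type*} [AddCommGroup M] [Module k M]
    (q : K.X (n+1) →ₗ[k] M)
    (hq : ∀ y, ∃ x, (K.d (n+1) (n+2)).hom x = 0 ∧ q x = y)
    (hk : ∀ x, (K.d (n+1) (n+2)).hom x = 0 → (q x = 0 ↔ ∃ z, (K.d n (n+1)).hom z = x)) :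
    Nonempty (K.homology (n+1) ≃+ M) := by
  let S := K.sc' n (n+1) (n+2)
  let i1 : K.homology (n+1) ≅ S.homology := K.homologyIsoSc' n (n+1) (n+2) (by simp) (by simp)
  let i2 := S.moduleCatHomologyIso
  let e1 := (i1 ≪≫ i2).toLinearEquiv
  let q' : LinearMap.ker S.g.hom →ₗ[k] M := q ∘ₗ (LinearMap.ker S.g.hom).subtype
  have hs : Function.Surjective q' := by
    intro y
    obtain ⟨x, hx, hy⟩ := hq y
    exact ⟨⟨x, hx⟩, hy⟩
  have hr : LinearMap.range S.moduleCatToCycles = LinearMap.ker q' := by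
    ext ⟨x, hx⟩
    rw [LinearMap.mem_ker]
    refine Iff.trans ?_ (hk x hx).symm
    constructor
    · rintro ⟨z, hz⟩
      exact ⟨z, congrArg Subtype.val hz⟩
    · rintro ⟨z, hz⟩
      exact ⟨z, Subtype.ext hz⟩
  let e2 : (LinearMap.ker S.g.hom ⧸ LinearMap.range S.moduleCatToCycles) ≃ₗ[k] M :=
    (Submodule.quotEquivOfEq _ _ hr).trans (q'.quotKerEquivOfSurjective hs)
  exact ⟨(e1.trans e2).toAddEquiv⟩
end hom

variable (p) in
def ss (m : ℕ) : ℤ := if Even m then p else 0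

lemma aug_cA (m : ℕ) : aug p (cA p m) = ss p m := by
  unfold cA ss; split_ifs <;> simp [aug_eN, aug_ea]
lemma aug_cB (m : ℕ) : aug p (cB p m) = ss p m := by
  unfold cB ss; split_ifs <;> simp [aug_eM, aug_eb]

variable (p) in
def DD (n : ℕ) (b : ℕ → ℤ) (j : ℕ) : ℤ :=
  ss p j * (if j = 0 then 0 else b (j-1)) + (-1)^j * ss p (n+1-j) * b j

lemma delta (n : ℕ) (φ : PP ℤ (Gp p) n ⟶ TT p) (j : Fin (n+2)) :
    homEq (n+1) (TT p) (dP p n ≫ φ) j = DD p n (ext0 (homEq n (TT p) φ : Fin (n+1) → ℤ)) j := by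
  set c : Fin (n+1) → ℤ := homEq n (TT p) φ with hc
  have h1 : (homEq (n+1) (TT p) (dP p n ≫ φ) j : ℤ) =
      ∑ i, aug p (dd p n (Pi.single j 1) i) * c i := by
    refine (hom_eq φ (dd p n (Pi.single j 1))).trans ?_
    exact Finset.sum_congr rfl fun i _ => asAlg_TT _ _
  rw [h1]
  simp only [dd_apply, map_add, map_mul, map_pow, map_neg, map_one, aug_cA, aug_cB, add_mul,
    Finset.sum_add_distrib]
  unfold DD
  congr 1
  · induction j using Fin.cases with
    | zero =>
      simp only [Fin.val_zero, if_true, mul_zero]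
      refine Finset.sum_eq_zero fun i _ => ?_
      rw [Pi.single_eq_of_ne (Fin.succ_ne_zero i)]; simp
    | succ k =>
      rw [Finset.sum_eq_single k]
      · simp [ext0_val]
      · intro i _ hi
        rw [Pi.single_eq_of_ne (by simpa using hi)]; simp
      · simp
  · induction j using Fin.lastCases with
    | last =>
      rw [Finset.sum_eq_zero]
      · simp [ext0]
      · intro i _
        rw [Pi.single_eq_of_ne (Fin.castSucc_lt_last i).ne]; simp
    | cast k =>
      rw [Finset.sum_eq_single k]
      · simp [ext0_val]
      · intro i _ hi
        rw [Pi.single_eq_of_ne (by simpa using hi)]; simp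
      · simp

variable (p) in
abbrev KK : CochainComplex (ModuleCat ℤ) ℕ := (CC p).linearYonedaObj ℤ (TT p)

variable (p) in
def ee (n : ℕ) : (KK p).X n ≃ₗ[ℤ] (Fin (n+1) → ℤ) := homEq n (TT p)

lemma ee_d (n : ℕ) (x : (KK p).X n) (j : Fin (n+2)) :
    ee p (n+1) (((KK p).d n (n+1)).hom x) j = DD p n (ext0 (ee p n x)) j := by
  refine Eq.trans ?_ (delta n x j)
  have : ((KK p).d n (n+1)).hom x = (CC p).d (n+1) n ≫ (show PP ℤ (Gp p) n ⟶ TT p from x) := rfl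
  rw [this, CC_d]
  rfl

lemma ext0_ge {n : ℕ} (f : Fin n → ℤ) (i : ℕ) (h : n ≤ i) : ext0 f i = 0 := by
  simp [ext0, h]

lemma ext0_mk (n : ℕ) (B : ℕ → ℤ) (i : ℕ) : ext0 (fun j : Fin n => B j) i = if i < n then B i else 0 := by
  simp [ext0]


lemma ss_even {m : ℕ} (h : Even m) : ss p m = p := by simp [ss, h]
lemma ss_odd {m : ℕ} (h : ¬ Even m) : ss p m = 0 := by simp [ss, h]

lemma DD_zero (n : ℕ) (b : ℕ → ℤ) : DD p n b 0 = ss p (n+1) * b 0 := by simp [DD]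
lemma DD_even (n : ℕ) (b : ℕ → ℤ) (i : ℕ) :
    DD p n b (2*i+2) = p * b (2*i+1) + ss p (n+1-(2*i+2)) * b (2*i+2) := by
  simp [DD, ss_even (p := p) (m := 2*i+2) (by grind), Even.neg_one_pow (n := 2*i+2) (by grind)]
lemma DD_odd (n : ℕ) (b : ℕ → ℤ) (i : ℕ) :
    DD p n b (2*i+1) = - ss p (n+1-(2*i+1)) * b (2*i+1) := by
  simp [DD, ss_odd (p := p) (m := 2*i+1) (by grind), Odd.neg_one_pow (n := 2*i+1) (by grind)]

lemma trich (j : ℕ) : j = 0 ∨ (∃ i, j = 2*i+1) ∨ ∃ i, j = 2*i+2 := by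
  rcases Nat.even_or_odd' j with ⟨i, rfl | rfl⟩
  · rcases i with _ | i
    · simp
    · right; right; exact ⟨i, by ring⟩
  · right; left; exact ⟨i, rfl⟩

lemma even_s (m : ℕ) (y : ℕ → ℤ) : ∃ c : ℕ → ℤ, (∀ i ≥ 2*m+1+2, c i = 0) ∧
      (∀ j < 2*m+1+3, DD p (2*m+1+1) c j = 0) ∧ ∀ i < m + 2, c (2*i) = y i := by
  refine ⟨fun j => if j < 2*m+3 then (if Even j then y (j/2) else 0) else 0, ?_, ?_, ?_⟩
  · intro i hi; simp only [if_neg (show ¬ i < 2*m+3 by omega)]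
  · intro j hj
    rcases trich j with rfl | ⟨i, rfl⟩ | ⟨i, rfl⟩
    · rw [DD_zero, ss_odd (by grind)]; simp
    · rw [DD_odd]; simp
    · rw [DD_even, ss_odd (by grind)]; simp
  · intro i hi
    simp only [if_pos (show 2 * i < 2*m+3 by omega)]; simp

lemma even_k (m : ℕ) (c : ℕ → ℤ) (_ : ∀ i ≥ 2*m+1+2, c i = 0)
    (hc : ∀ j < 2*m+1+3, DD p (2*m+1+1) c j = 0) :
    ((∀ i < m+2, (p : ℤ) ∣ c (2*i)) ↔ ∃ b : ℕ → ℤ, (∀ i ≥ 2*m+1+1, b i = 0) ∧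
      ∀ j < 2*m+1+2, DD p (2*m+1) b j = c j) := by
  have hp : (p : ℤ) ≠ 0 := by exact_mod_cast (Fact.out : p.Prime).ne_zero
  have hodd : ∀ i, 2*i+1 < 2*m+3 → c (2*i+1) = 0 := by
    intro i hi
    have := hc (2*i+1) (by omega)
    rw [DD_odd, ss_even (by grind)] at this
    simpa [(Fact.out : p.Prime).ne_zero] using this
  constructor
  · intro h
    choose! z hz using h
    refine ⟨fun j => if j = 2*m+1 then z (m+1) else if j < 2*m+1 ∧ Even j then z (j/2) else 0, ?_, ?_⟩
    · intro i hi
      simp only [if_neg (show ¬ i = 2*m+1 by omega), if_neg (show ¬ (i < 2*m+1 ∧ Even i) by omega)]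
    · intro j hj
      rcases trich j with rfl | ⟨i, rfl⟩ | ⟨i, rfl⟩
      · rw [DD_zero, ss_even (by grind)]
        have := hz 0 (by omega)
        simp at this ⊢; exact this.symm
      · rw [DD_odd, ss_odd (by grind), hodd i (by omega)]; simp
      · rw [DD_even, ss_even (by grind)]
        have := hz (i+1) (by omega)
        rw [show 2*(i+1) = 2*i+2 by ring] at this
        rw [this]
        have h2 : (2*i+2)/2 = i+1 := by omega
        rcases Nat.lt_or_ge i m with h | h
        · simp only [if_neg (show ¬ 2*i+1 = 2*m+1 by omega),
            if_neg (show ¬ (2*i+1 < 2*m+1 ∧ Even (2*i+1)) by grind),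
            if_neg (show ¬ 2*i+2 = 2*m+1 by omega),
            if_pos (show (2*i+2 < 2*m+1 ∧ Even (2*i+2)) by grind), h2]
          ring
        · obtain rfl : i = m := by omega
          simp
  · rintro ⟨b, hb, h⟩ i hi
    rw [← h _ (by omega)]
    rcases i with _ | i
    · rw [mul_zero, DD_zero, ss_even (by grind)]; exact dvd_mul_right _ _
    · rw [show 2*(i+1) = 2*i+2 by ring, DD_even, ss_even (by grind), ← mul_add]
      exact dvd_mul_right _ _

lemma odd_s (m : ℕ) (y : ℕ → ℤ) : ∃ c : ℕ → ℤ, (∀ i ≥ 2*m+2, c i = 0) ∧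
      (∀ j < 2*m+3, DD p (2*m+1) c j = 0) ∧ ∀ i < m, c (2*i+1) = y i := by
  refine ⟨fun j => if 0 < j ∧ j < 2*m+1 then (if Even j then - y (j/2-1) else y (j/2)) else 0, ?_, ?_, ?_⟩
  · intro i hi; simp only [if_neg (show ¬ (0 < i ∧ i < 2*m+1) by omega)]
  · intro j hj
    rcases trich j with rfl | ⟨i, rfl⟩ | ⟨i, rfl⟩
    · rw [DD_zero]; simp
    · rw [DD_odd, ss_odd (by grind)]; simp
    · rw [DD_even, ss_even (by grind)]
      have h2 : (2*i+2)/2-1 = i := by omega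
      have h3 : (2*i+1)/2 = i := by omega
      rcases Nat.lt_or_ge i m with h | h
      · simp only [if_pos (show 0 < 2*i+1 ∧ 2*i+1 < 2*m+1 by omega),
          if_pos (show 0 < 2*i+2 ∧ 2*i+2 < 2*m+1 by omega), if_pos (show Even (2*i+2) by grind),
          if_neg (show ¬ Even (2*i+1) by grind), h2, h3]
        ring
      · simp only [if_neg (show ¬ (0 < 2*i+1 ∧ 2*i+1 < 2*m+1) by omega),
          if_neg (show ¬ (0 < 2*i+2 ∧ 2*i+2 < 2*m+1) by omega)]
        ring
  · intro i hi
    have h3 : (2*i+1)/2 = i := by omega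
    simp only [if_pos (show 0 < 2*i+1 ∧ 2*i+1 < 2*m+1 by omega),
          if_neg (show ¬ Even (2*i+1) by grind), h3]

lemma odd_k (m : ℕ) (c : ℕ → ℤ) (h0 : ∀ i ≥ 2*m+2, c i = 0)
    (hc : ∀ j < 2*m+3, DD p (2*m+1) c j = 0) :
    ((∀ i < m, (p : ℤ) ∣ c (2*i+1)) ↔ ∃ b : ℕ → ℤ, (∀ i ≥ 2*m+1, b i = 0) ∧
      ∀ j < 2*m+2, DD p (2*m) b j = c j) := by
  have hp : (p : ℤ) ≠ 0 := by exact_mod_cast (Fact.out : p.Prime).ne_zero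
  have hc0 : c 0 = 0 := by
    have := hc 0 (by omega)
    rw [DD_zero, ss_even (by grind)] at this
    simpa [(Fact.out : p.Prime).ne_zero] using this
  have hce : ∀ i ≤ m, c (2*i+2) = - c (2*i+1) := by
    intro i hi
    have := hc (2*i+2) (by omega)
    rw [DD_even, ss_even (by grind), ← mul_add] at this
    have := (mul_eq_zero.1 this).resolve_left hp
    linarith
  constructor
  · intro h
    choose! z hz using h
    refine ⟨fun j => if j < 2*m ∧ ¬ Even j then - z (j/2) else 0, ?_, ?_⟩
    · intro i hi
      simp only [if_neg (show ¬ (i < 2*m ∧ ¬ Even i) by omega)]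
    · intro j hj
      rcases trich j with rfl | ⟨i, rfl⟩ | ⟨i, rfl⟩
      · rw [DD_zero, ss_odd (by grind), hc0]; simp
      · rw [DD_odd, ss_even (by grind)]
        have h3 : (2*i+1)/2 = i := by omega
        rcases Nat.lt_or_ge i m with h | h
        · simp only [if_pos (show (2*i+1 < 2*m ∧ ¬ Even (2*i+1)) by grind), h3, hz i h]
          ring
        · obtain rfl : i = m := by omega
          have := hce i le_rfl
          rw [h0 _ (by omega)] at this
          simp only [if_neg (show ¬ (2*i+1 < 2*i ∧ ¬ Even (2*i+1)) by omega)]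
          linarith
      · rw [DD_even, ss_odd (by grind), hce i (by omega), hz i (by omega)]
        have h3 : (2*i+1)/2 = i := by omega
        simp only [if_pos (show (2*i+1 < 2*m ∧ ¬ Even (2*i+1)) by grind), h3]
        ring
  · rintro ⟨b, hb, h⟩ i hi
    rw [← h _ (by omega), DD_odd, ss_even (by grind)]
    exact Dvd.intro (- b (2*i+1)) (by ring)

/-- combinatorial criterion -/
lemma main_crit (n r : ℕ) (t : ℕ → ℕ)
    (hs : ∀ y : ℕ → ℤ, ∃ c : ℕ → ℤ, (∀ i ≥ n + 2, c i = 0) ∧ (∀ j < n + 3, DD p (n+1) c j = 0) ∧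
      ∀ i < r, c (t i) = y i)
    (hk : ∀ c : ℕ → ℤ, (∀ i ≥ n + 2, c i = 0) → (∀ j < n + 3, DD p (n+1) c j = 0) → 
      ((∀ i < r, (p : ℤ) ∣ c (t i)) ↔ ∃ b : ℕ → ℤ, (∀ i ≥ n + 1, b i = 0) ∧ ∀ j < n + 2, DD p n b j = c j)) :
    Nonempty (groupCohomology (TT p) (n+1) ≃+ (Fin r → ZMod p)) := by
  have hp0 : NeZero p := ⟨(Fact.out : p.Prime).ne_zero⟩
  have key : Nonempty ((KK p).homology (n+1) ≃+ (Fin r → ZMod p)) := by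
    let q0 : (Fin (n+2) → ℤ) →+ (Fin r → ZMod p) :=
      { toFun := fun c i => ((ext0 c (t i) : ℤ) : ZMod p)
        map_zero' := by ext1 i; simp [ext0]
        map_add' := fun a b => by
          ext1 i; simp only [ext0, Pi.add_apply]; split_ifs <;> simp }
    have hd : ∀ m (x : (KK p).X m) (w : (KK p).X (m+1)), ((KK p).d m (m+1)).hom x = w ↔
        ∀ j < m + 2, DD p m (ext0 (ee p m x)) j = ext0 (ee p (m+1) w) j := by
      intro m x w
      rw [← (ee p (m+1)).injective.eq_iff]
      constructor
      · intro h j hj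
        rw [← h, ← ee_d m x ⟨j, hj⟩]
        exact (ext0_val _ (⟨j, hj⟩ : Fin (m+2))).symm
      · intro h
        ext1 j
        rw [ee_d, h j j.2, ext0_val]
    have hz : ∀ m i, ext0 (ee p m 0) i = 0 := by intro m i; simp [ext0]
    have hmk : ∀ m (c : ℕ → ℤ), (∀ i ≥ m + 1, c i = 0) →
        ext0 (ee p m ((ee p m).symm (fun j => c j))) = c := by
      intro m c hc
      ext1 i
      rw [LinearEquiv.apply_symm_apply, ext0_mk]
      split_ifs with h
      · rfl
      · rw [hc i (by omega)]
    refine homology_of (KK p) n (q0.toIntLinearMap ∘ₗ (ee p (n+1)).toLinearMap) ?_ ?_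
    · intro y
      obtain ⟨c, h0, h1, h2⟩ := hs (ext0 (fun i => ((y i).val : ℤ)))
      refine ⟨(ee p (n+1)).symm (fun j => c j), ?_, ?_⟩
      · rw [hd]
        intro j hj
        rw [hmk _ _ h0, hz, h1 j hj]
      · ext1 i
        change ((ext0 (ee p (n+1) ((ee p (n+1)).symm (fun j => c j))) (t i) : ℤ) : ZMod p) = y i
        rw [hmk _ _ h0, h2 i i.2, ext0_val]
        simp
    · intro x hx
      rw [hd] at hx
      refine Iff.trans ?_ ((hk (ext0 (ee p (n+1) x)) (fun i hi => ext0_ge _ _ hi) 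
        (fun j hj => by rw [hx j hj, hz])).trans ?_)
      · constructor
        · intro h i hi
          have := congrFun h ⟨i, hi⟩
          exact (ZMod.intCast_zmod_eq_zero_iff_dvd _ _).1 this
        · intro h
          ext1 i
          exact (ZMod.intCast_zmod_eq_zero_iff_dvd _ _).2 (h i i.2)
      · constructor
        · rintro ⟨b, hb, hb'⟩
          refine ⟨(ee p n).symm (fun j => b j), ?_⟩
          rw [hd, hmk _ _ hb]
          exact hb'
        · rintro ⟨z, hz⟩
          rw [hd] at hz
          exact ⟨_, fun i hi => ext0_ge _ _ hi, hz⟩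
  obtain ⟨e⟩ := key
  exact ⟨(groupCohomologyIso (TT p) (n+1) (resP p)).toLinearEquiv.toAddEquiv.trans e⟩

end
end ZpZp

/-- Integral group cohomology of `ℤ/p × ℤ/p` (with trivial coefficients):
`H⁰ ≅ ℤ`, `H¹ = 0`, `H^k ≅ (ℤ/p)^((k-1)/2)` for odd `k > 1`, and
`H^k ≅ (ℤ/p)^((k+2)/2)` for even `k > 1`. -/
theorem integral_cohomology_of_ZpxZp (p : ℕ) [Fact p.Prime] (hp : Odd p) :
    Nonempty ((groupCohomology (Rep.trivial ℤ (Multiplicative (ZMod p × ZMod p)) ℤ) 0) ≃+ ℤ) ∧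
    (∀ x : groupCohomology (Rep.trivial ℤ (Multiplicative (ZMod p × ZMod p)) ℤ) 1, x = 0) ∧
    (∀ k : ℕ, 1 < k → Odd k →
      Nonempty ((groupCohomology (Rep.trivial ℤ (Multiplicative (ZMod p × ZMod p)) ℤ) k) ≃+
        (Fin ((k - 1) / 2) → ZMod p))) ∧
    (∀ k : ℕ, 1 < k → Even k →
      Nonempty ((groupCohomology (Rep.trivial ℤ (Multiplicative (ZMod p × ZMod p)) ℤ) k) ≃+
        (Fin ((k + 2) / 2) → ZMod p))) := by
  refine ⟨?_, ?_, ?_, ?_⟩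
  · exact ⟨(groupCohomology.H0IsoOfIsTrivial
      (Rep.trivial ℤ (Multiplicative (ZMod p × ZMod p)) ℤ)).toLinearEquiv.toAddEquiv⟩
  · obtain ⟨e⟩ := ZpZp.main_crit (p := p) 0 0 (fun i => 2*i+1) (ZpZp.odd_s 0) (ZpZp.odd_k 0)
    intro x
    exact e.injective (Subsingleton.elim _ _)
  · rintro k hk ⟨m, rfl⟩
    rw [show (2 * m + 1 - 1) / 2 = m by omega]
    exact ZpZp.main_crit (p := p) (2*m) m (fun i => 2*i+1) (ZpZp.odd_s m) (ZpZp.odd_k m)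
  · intro k hk hke
    obtain ⟨m, rfl⟩ : ∃ m, k = 2*m+1+1 := by
      obtain ⟨m, rfl⟩ := hke
      exact ⟨m - 1, by omega⟩
    rw [show (2*m+1+1+2) / 2 = m + 2 by omega]
    exact ZpZp.main_crit (p := p) (2*m+1) (m+2) (fun i => 2*i) (ZpZp.even_s m) (ZpZp.even_k m)
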